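/- Let μ > 0, 0 < p ≤ 1, and let F be the distribution function of a nonnegative random variable with mean 1/μ satisfying sup_{x≥0, y≥0} |F_y(x) − F(x)| < ε, and suppose F belongs either to the class NBU or to the class NWU. Let B(x) = p·F(x) + (1−p)·(1 − e^{−μx}) be the distribution function of a nonnegative random variable χ. Then sup_{x≥0, y≥0} |B_y(x) − B(x)| < 3ε, where B_y(x) = Pr{χ ≤ x + y | χ > y}. -/

import Mathlib

open MeasureTheory Real Set

/-- The conditional distribution function `G_y(x) = Pr{ξ ≤ x + y | ξ > y}
= (G(x+y) - G(y)) / (1 - G(y))`, with the convention `0/0 = 0`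
(which is automatic for real division in Lean). -/
noncomputable def condF (G : ℝ → ℝ) (y x : ℝ) : ℝ := (G (x + y) - G y) / (1 - G y)

/-- A distribution function `Ξ` of a nonnegative random variable is NBU if
`Ξ̄(x+y) ≤ Ξ̄(x)·Ξ̄(y)` for all `x, y ≥ 0`. -/
def IsNBU (Ξ : ℝ → ℝ) : Prop :=
  ∀ x ≥ (0:ℝ), ∀ y ≥ (0:ℝ), 1 - Ξ (x + y) ≤ (1 - Ξ x) * (1 - Ξ y)

/-- A distribution function `Ξ` of a nonnegative random variable is NWU if
`Ξ̄(x+y) ≥ Ξ̄(x)·Ξ̄(y)` for all `x, y ≥ 0`. -/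
def IsNWU (Ξ : ℝ → ℝ) : Prop :=
  ∀ x ≥ (0:ℝ), ∀ y ≥ (0:ℝ), (1 - Ξ x) * (1 - Ξ y) ≤ 1 - Ξ (x + y)

/-- A nonnegative antitone right-continuous function with integral `1 / μ` over `(0, ∞)` that is
multiplicative up to a relative error `δ` is uniformly `2 δ`-close to `exp (-μ x)`. -/
theorem abs_sub_exp_le_of_almost_multiplicative {S : ℝ → ℝ} {μ δ : ℝ} (hμ : 0 < μ)
    (hanti : Antitone S) (hcont : ∀ x, ContinuousWithinAt S (Ioi x) x)
    (hS : IntegrableOn S (Ioi 0)) (hmean : ∫ t in Ioi 0, S t = 1 / μ)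
    (hmul : ∀ x ≥ (0 : ℝ), ∀ y ≥ (0 : ℝ), |S x * S y - S (x + y)| ≤ δ * S y)
    {x : ℝ} (hx : 0 ≤ x) : |S x - exp (-μ * x)| ≤ 2 * δ := by
  have hii : ∀ a b, IntervalIntegrable S volume a b := fun a b => hanti.intervalIntegrable
  set g : ℝ → ℝ := fun x => 1 - μ * ∫ t in (0 : ℝ)..x, S t with hg
  have htail : ∀ x ≥ (0 : ℝ), g x = μ * ∫ t in Ioi 0, S (x + t) := by
    intro x hx
    have h1 := intervalIntegral.integral_interval_add_Ioi hS (hS.mono_set (Ioi_subset_Ioi hx))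
    have h2 : ∫ t in Ioi 0, S (x + t) = ∫ t in Ioi x, S t := by
      have := (measurePreserving_add_left volume x).setIntegral_preimage_emb
        (measurableEmbedding_addLeft x) S (Ioi x)
      simpa using this
    rw [h2, hg]
    simp only
    rw [eq_sub_of_add_eq h1, hmean]
    field_simp
    ring
  have hint_shift : ∀ x ≥ (0 : ℝ), IntegrableOn (fun t => S (x + t)) (Ioi 0) := by
    intro x hx
    have := (measurePreserving_add_left volume x).integrableOn_comp_preimage
      (measurableEmbedding_addLeft x) (f := S) (s := Ioi x)
    have h := this.2 (hS.mono_set (Ioi_subset_Ioi hx))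
    simpa [Function.comp_def] using h
  have hclose : ∀ x ≥ (0 : ℝ), |S x - g x| ≤ δ := by
    intro x hx
    have h1 : S x - g x = μ * ∫ t in Ioi 0, (S x * S t - S (x + t)) := by
      rw [integral_sub (hS.const_mul _) (hint_shift x hx), integral_const_mul, hmean, htail x hx]
      field_simp
    have h2 : ‖∫ t in Ioi 0, (S x * S t - S (x + t))‖ ≤ ∫ t in Ioi 0, δ * S t := by
      refine norm_integral_le_of_norm_le (hS.const_mul _) ?_
      filter_upwards [ae_restrict_mem measurableSet_Ioi] with t ht
      exact hmul x hx t (le_of_lt ht)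
    rw [integral_const_mul, hmean, norm_eq_abs] at h2
    rw [h1, abs_mul, abs_of_pos hμ]
    calc _ ≤ μ * (δ * (1 / μ)) := by gcongr
      _ = δ := by field_simp
  have hgderiv : ∀ x, HasDerivWithinAt g (-(μ * S x)) (Ici x) x := by
    intro x
    have := intervalIntegral.integral_hasDerivWithinAt_right (hii 0 x) (s := Ici x) (t := Ioi x)
      hanti.measurable.stronglyMeasurable.stronglyMeasurableAtFilter (hcont x)
    exact (this.const_mul μ).const_sub 1
  have hexp : ∀ x, HasDerivAt (fun t => exp (μ * t)) (exp (μ * x) * μ) x := fun x => by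
    simpa using ((hasDerivAt_id x).const_mul μ).exp
  have hgcont : Continuous g :=
    continuous_const.sub (continuous_const.mul (intervalIntegral.continuous_primitive hii 0))
  have key : |exp (μ * x) * g x - 1| ≤ δ * (exp (μ * x) - 1) := by
    refine image_norm_le_of_norm_deriv_right_le_deriv_boundary
      (f := fun t => exp (μ * t) * g t - 1) (a := 0) (b := x)
      (B := fun t => δ * (exp (μ * t) - 1)) (B' := fun t => δ * (exp (μ * t) * μ)) ?_
      (fun t _ => (((hexp t).hasDerivWithinAt.mul (hgderiv t)).sub_const 1)) ?_
      (fun t => ((hexp t).sub_const 1).const_mul δ) ?_ ⟨hx, le_rfl⟩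
    · fun_prop
    · simp [hg]
    · intro t ht
      have h := hclose t ht.1
      have : exp (μ * t) * μ * g t + exp (μ * t) * -(μ * S t)
          = -(exp (μ * t) * μ * (S t - g t)) := by ring
      rw [this, norm_neg, norm_mul, norm_of_nonneg (by positivity), norm_eq_abs]
      calc _ ≤ exp (μ * t) * μ * δ := by gcongr
        _ = _ := by ring
  have hδ : 0 ≤ δ := (abs_nonneg _).trans (hclose x hx)
  have hgexp : |g x - exp (-μ * x)| ≤ δ := by
    have hfac : g x - exp (-μ * x) = exp (-μ * x) * (exp (μ * x) * g x - 1) := by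
      rw [mul_sub, ← mul_assoc, ← exp_add]
      simp
    rw [hfac, abs_mul, abs_of_pos (exp_pos _)]
    calc _ ≤ exp (-μ * x) * (δ * (exp (μ * x) - 1)) := by gcongr
      _ = δ * (exp (-μ * x) * exp (μ * x) - exp (-μ * x)) := by ring
      _ = δ * (1 - exp (-μ * x)) := by rw [← exp_add]; simp
      _ ≤ δ := by nlinarith [exp_pos (-μ * x)]
  calc _ ≤ |S x - g x| + |g x - exp (-μ * x)| := abs_sub_le _ _ _
    _ ≤ 2 * δ := by linarith [hclose x hx]

/-- The error of approximate multiplicativity for a convex combination of survival functions. -/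
theorem abs_mixture_error_le {p q u v w e f δ : ℝ} (hp : 0 ≤ p) (hq : 0 ≤ q) (hpq : p + q = 1)
    (hv : 0 ≤ v) (hf : 0 ≤ f) (hmul : |u * v - w| ≤ δ * v) (hue : |u - e| ≤ 2 * δ) :
    |(p * u + q * e) * (p * v + q * f) - (p * w + q * (e * f))| ≤
      3 * δ * (p * v + q * f) := by
  obtain rfl : q = 1 - p := by linarith
  have hδ : 0 ≤ δ := by linarith [abs_nonneg (u - e)]
  have hid : (p * u + (1 - p) * e) * (p * v + (1 - p) * f) - (p * w + (1 - p) * (e * f))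
      = p * (u * v - w) - p * (1 - p) * ((u - e) * (v - f)) := by ring
  have hvf : |v - f| ≤ v + f := abs_le.2 ⟨by linarith, by linarith⟩
  rw [hid]
  calc _ ≤ |p * (u * v - w)| + |p * (1 - p) * ((u - e) * (v - f))| := abs_sub _ _
    _ = p * |u * v - w| + p * (1 - p) * (|u - e| * |v - f|) := by
      rw [abs_mul, abs_mul, abs_mul (u - e), abs_of_nonneg hp, abs_of_nonneg (mul_nonneg hp hq)]
    _ ≤ p * (δ * v) + p * (1 - p) * (2 * δ * (v + f)) := by gcongr
    _ ≤ 3 * δ * (p * v + (1 - p) * f) := by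
      have h1 : 0 ≤ δ * (p * p * v) := by positivity
      have h2 : 0 ≤ δ * ((1 - p) * (1 - p) * f) := by positivity
      have h3 : 0 ≤ δ * ((1 - p) * f) := by positivity
      nlinarith

/-- If `F` is the distribution function of a nonnegative random variable (with law `ν`)
with mean `1/μ` satisfying `sup_{x≥0,y≥0} |F_y(x) - F(x)| < ε`, `F` is NBU or NWU, and
`B(x) = p F(x) + (1-p)(1 - e^{-μx})` with `0 < p ≤ 1`, then
`sup_{x≥0,y≥0} |B_y(x) - B(x)| < 3ε`. -/
theorem losses_condition_B_uniform_bound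
    (μ ε p : ℝ) (hμ : 0 < μ) (hε : 0 < ε) (hp0 : 0 < p) (hp1 : p ≤ 1)
    (ν : Measure ℝ) [IsProbabilityMeasure ν] (hν : ν (Set.Iio 0) = 0)
    (F : ℝ → ℝ) (hF : ∀ x, F x = (ν (Set.Iic x)).toReal)
    (hint : Integrable (fun x => x) ν)
    (hmean : ∫ x, x ∂ν = 1 / μ)
    (hsup : sSup {d : ℝ | ∃ x ≥ (0:ℝ), ∃ y ≥ (0:ℝ), d = |condF F y x - F x|} < ε)
    (hclass : IsNBU F ∨ IsNWU F)
    (B : ℝ → ℝ)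
    (hB : ∀ x, B x = p * F x + (1 - p) * (1 - Real.exp (-μ * x))) :
    sSup {d : ℝ | ∃ x ≥ (0:ℝ), ∃ y ≥ (0:ℝ), d = |condF B y x - B x|} < 3 * ε := by
  set T : Set ℝ := {d : ℝ | ∃ x ≥ (0:ℝ), ∃ y ≥ (0:ℝ), d = |condF F y x - F x|}
  set δ := sSup T
  have hFcdf : F = ProbabilityTheory.cdf ν := by
    ext x
    rw [hF, ProbabilityTheory.cdf_eq_real, measureReal_def]
  have hmono : Monotone F := hFcdf ▸ ProbabilityTheory.monotone_cdf ν
  have hF0 : ∀ x, 0 ≤ F x := fun x => hFcdf ▸ ProbabilityTheory.cdf_nonneg ν x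
  have hF1 : ∀ x, F x ≤ 1 := fun x => hFcdf ▸ ProbabilityTheory.cdf_le_one ν x
  have hbdd : BddAbove T := by
    refine ⟨1, ?_⟩
    rintro d ⟨x, hx, y, hy, rfl⟩
    have h1 : 0 ≤ condF F y x :=
      div_nonneg (sub_nonneg.2 (hmono (by linarith))) (sub_nonneg.2 (hF1 y))
    have h2 : condF F y x ≤ 1 :=
      div_le_one_of_le₀ (by linarith [hF1 (x + y)]) (sub_nonneg.2 (hF1 y))
    exact abs_le.2 ⟨by linarith [hF1 x], by linarith [hF0 x]⟩
  have hle : ∀ x ≥ (0 : ℝ), ∀ y ≥ (0 : ℝ), |condF F y x - F x| ≤ δ :=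
    fun x hx y hy => le_csSup hbdd ⟨x, hx, y, hy, rfl⟩
  have hmul : ∀ x ≥ (0 : ℝ), ∀ y ≥ (0 : ℝ),
      |(1 - F x) * (1 - F y) - (1 - F (x + y))| ≤ δ * (1 - F y) := by
    intro x hx y hy
    rcases (hF1 y).eq_or_lt with h | h
    · have : F (x + y) = 1 := le_antisymm (hF1 _) (h ▸ hmono (by linarith))
      simp [h, this]
    · have hpos : 0 < 1 - F y := by linarith
      have hid : (1 - F x) * (1 - F y) - (1 - F (x + y)) = (condF F y x - F x) * (1 - F y) := by
        rw [condF, sub_mul (_ / _), div_mul_cancel₀ _ hpos.ne']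
        ring
      rw [hid, abs_mul, abs_of_pos hpos]
      exact mul_le_mul_of_nonneg_right (hle x hx y hy) hpos.le
  have hnonneg : 0 ≤ᵐ[ν] fun x : ℝ => x := by
    have : ∀ᵐ x ∂ν, x ∉ Iio (0 : ℝ) := measure_eq_zero_iff_ae_notMem.1 hν
    filter_upwards [this] with x hx
    exact not_lt.1 hx
  have hS_mean : ∫ t in Ioi 0, (1 - F t) = 1 / μ := by
    rw [← hmean, hint.integral_eq_integral_meas_lt hnonneg]
    congr with t
    rw [hF, ← measureReal_def, ← probReal_compl_eq_one_sub measurableSet_Iic, compl_Iic]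
    rfl
  have hS_int : IntegrableOn (fun t => 1 - F t) (Ioi 0) := by
    by_contra h
    rw [integral_undef h] at hS_mean
    exact (one_div_pos.2 hμ).ne hS_mean
  have hcont : ∀ x, ContinuousWithinAt (fun t => 1 - F t) (Ioi x) x := fun x => by
    rw [hFcdf]
    exact continuousWithinAt_const.sub
      (((ProbabilityTheory.cdf ν).right_continuous x).mono Ioi_subset_Ici_self)
  have hexp : ∀ x ≥ (0 : ℝ), |(1 - F x) - exp (-μ * x)| ≤ 2 * δ := fun x hx =>
    abs_sub_exp_le_of_almost_multiplicative (S := fun t => 1 - F t) hμ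
      (fun a b hab => sub_le_sub_left (hmono hab) 1) hcont hS_int hS_mean hmul hx
  refine lt_of_le_of_lt (csSup_le ⟨_, 0, le_rfl, 0, le_rfl, rfl⟩ ?_)
    (mul_lt_mul_of_pos_left hsup (by norm_num : (0 : ℝ) < 3))
  rintro d ⟨x, hx, y, hy, rfl⟩
  rcases hp1.eq_or_lt with rfl | hp1
  · obtain rfl : B = F := by
      ext t
      simp [hB]
    have h := hle x hx y hy
    linarith [(abs_nonneg _).trans h]
  · have hSB : ∀ t, 1 - B t = p * (1 - F t) + (1 - p) * exp (-μ * t) := fun t => by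
      rw [hB]
      ring
    have hpos : 0 < 1 - B y := by
      rw [hSB]
      have := mul_pos (sub_pos.2 hp1) (exp_pos (-μ * y))
      have := mul_nonneg hp0.le (sub_nonneg.2 (hF1 y))
      linarith
    have hid : condF B y x - B x
        = ((1 - B x) * (1 - B y) - (1 - B (x + y))) / (1 - B y) := by
      rw [condF, eq_div_iff hpos.ne', sub_mul, div_mul_cancel₀ _ hpos.ne']
      ring
    rw [hid, abs_div, abs_of_pos hpos, div_le_iff₀ hpos, hSB, hSB, hSB, mul_add (-μ), exp_add]
    exact abs_mixture_error_le hp0.le (sub_nonneg.2 hp1.le) (by ring) (sub_nonneg.2 (hF1 y))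
      (exp_pos _).le (hmul x hx y hy) (hexp x hx)
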